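/- arXiv:1403.1522 — 2 statements merged into one kernel-verified Lean document; each statement's English description precedes it below -/
import Mathlib

section
/- Let v be subharmonic on Q and let s < p be real numbers such that v ≤ s on the bottom edge γ₁ and v ≤ p on each of the edges γ₂, γ₃, γ₄. Then v(0, x₂) ≤ (s + 3p)/4 for every x₂ with 0 < x₂ < 1, i.e. v ≤ (s+3p)/4 on the segment l = {0} × (0,1). -/
open MeasureTheory Real

/-- A function `v` is subharmonic on an open set `Q ⊆ ℝ²` if it is continuous on the
closure of `Q` and satisfies the sub-mean-value inequality on every closed disc
contained in `Q`. -/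
def SubharmonicOnSet (v : ℝ × ℝ → ℝ) (Q : Set (ℝ × ℝ)) : Prop :=
  ContinuousOn v (closure Q) ∧
  ∀ (p : ℝ × ℝ) (r : ℝ), 0 < r →
    {q : ℝ × ℝ | (q.1 - p.1) ^ 2 + (q.2 - p.2) ^ 2 ≤ r ^ 2} ⊆ Q →
    v p ≤ (2 * Real.pi)⁻¹ *
      ∫ θ in (0 : ℝ)..(2 * Real.pi), v (p.1 + r * Real.cos θ, p.2 + r * Real.sin θ)

/-- A point of the circle of radius `r` about `p`, parametrised by the angle, lies in a set
containing the closed disc. -/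
theorem circle_mem_of_disc_subset {Q : Set (ℝ × ℝ)} {p : ℝ × ℝ} {r : ℝ}
    (h : {q : ℝ × ℝ | (q.1 - p.1) ^ 2 + (q.2 - p.2) ^ 2 ≤ r ^ 2} ⊆ Q) (θ : ℝ) :
    (p.1 + r * Real.cos θ, p.2 + r * Real.sin θ) ∈ Q := by
  apply h
  simp only [Set.mem_ofPred_eq, add_sub_cancel_left]
  nlinarith [Real.sin_sq_add_cos_sq θ]

/-- A function continuous on `closure Q` is continuous along circles bounding discs in `Q`. -/
theorem continuous_circle_of_disc_subset {u : ℝ × ℝ → ℝ} {Q : Set (ℝ × ℝ)} {p : ℝ × ℝ} {r : ℝ}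
    (hu : ContinuousOn u (closure Q))
    (h : {q : ℝ × ℝ | (q.1 - p.1) ^ 2 + (q.2 - p.2) ^ 2 ≤ r ^ 2} ⊆ Q) :
    Continuous fun θ : ℝ => u (p.1 + r * Real.cos θ, p.2 + r * Real.sin θ) :=
  hu.comp_continuous (by fun_prop) fun θ => subset_closure (circle_mem_of_disc_subset h θ)

theorem SubharmonicOnSet.mono {u : ℝ × ℝ → ℝ} {Q Q' : Set (ℝ × ℝ)}
    (hu : SubharmonicOnSet u Q) (h : Q' ⊆ Q) : SubharmonicOnSet u Q' :=
  ⟨hu.1.mono (closure_mono h), fun p r hr hd => hu.2 p r hr (hd.trans h)⟩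

theorem SubharmonicOnSet.add {u w : ℝ × ℝ → ℝ} {Q : Set (ℝ × ℝ)}
    (hu : SubharmonicOnSet u Q) (hw : SubharmonicOnSet w Q) :
    SubharmonicOnSet (fun q => u q + w q) Q := by
  refine ⟨hu.1.add hw.1, fun p r hr hd => ?_⟩
  rw [intervalIntegral.integral_add
    ((continuous_circle_of_disc_subset hu.1 hd).intervalIntegrable _ _)
    ((continuous_circle_of_disc_subset hw.1 hd).intervalIntegrable _ _), mul_add]
  exact add_le_add (hu.2 p r hr hd) (hw.2 p r hr hd)

/-- Rotation of the plane by a quarter turn about `c`. -/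
def quarterTurn (c q : ℝ × ℝ) : ℝ × ℝ := (c.1 - (q.2 - c.2), c.2 + (q.1 - c.1))

/-- Subharmonicity is invariant under quarter turns. -/
theorem SubharmonicOnSet.comp_quarterTurn {u : ℝ × ℝ → ℝ} {Q : Set (ℝ × ℝ)}
    (hu : SubharmonicOnSet u Q) (c : ℝ × ℝ) :
    SubharmonicOnSet (fun q => u (quarterTurn c q)) (quarterTurn c ⁻¹' Q) := by
  have hc : Continuous (quarterTurn c) := by unfold quarterTurn; fun_prop
  refine ⟨hu.1.comp hc.continuousOn (hc.closure_preimage_subset Q), fun p r hr hd => ?_⟩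
  have hd' : {q : ℝ × ℝ | (q.1 - (quarterTurn c p).1) ^ 2 + (q.2 - (quarterTurn c p).2) ^ 2
      ≤ r ^ 2} ⊆ Q := by
    intro q hq
    have hmem : (c.1 + (q.2 - c.2), c.2 - (q.1 - c.1)) ∈ quarterTurn c ⁻¹' Q := by
      apply hd
      simp only [Set.mem_ofPred_eq, quarterTurn] at hq ⊢
      linarith
    simpa [quarterTurn] using hmem
  refine (hu.2 _ r hr hd').trans_eq ?_
  congr 1
  set g : ℝ → ℝ := fun θ =>
    u ((quarterTurn c p).1 + r * Real.cos θ, (quarterTurn c p).2 + r * Real.sin θ) with hg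
  have hper : Function.Periodic g (2 * Real.pi) := fun θ => by
    simp only [hg, Real.cos_add_two_pi, Real.sin_add_two_pi]
  have hshift : ∀ θ, u (quarterTurn c (p.1 + r * Real.cos θ, p.2 + r * Real.sin θ)) =
      g (θ + Real.pi / 2) := fun θ => by
    simp only [hg, quarterTurn, Real.cos_add_pi_div_two, Real.sin_add_pi_div_two]
    congr 2 <;> ring
  simp only [hshift]
  rw [intervalIntegral.integral_comp_add_right, zero_add, add_comm (2 * Real.pi),
    hper.intervalIntegral_add_eq (Real.pi / 2) 0, zero_add]

/-- The weak maximum principle on bounded open sets. -/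
theorem SubharmonicOnSet.le_of_le_on_frontier {u : ℝ × ℝ → ℝ} {Q : Set (ℝ × ℝ)} {M : ℝ}
    (hu : SubharmonicOnSet u Q) (hQ : IsOpen Q) (hb : Bornology.IsBounded Q)
    (hM : ∀ q ∈ frontier Q, u q ≤ M) : ∀ q ∈ closure Q, u q ≤ M := by
  intro q₀ hq₀
  by_contra! hlt
  have hK : IsCompact (closure Q) := hb.isCompact_closure
  obtain ⟨z, hz, hzmax⟩ := hK.exists_isMaxOn ⟨q₀, hq₀⟩ hu.1
  have hA : IsCompact (closure Q ∩ u ⁻¹' {u z}) :=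
    hK.of_isClosed_subset (hu.1.preimage_isClosed_of_isClosed isClosed_closure isClosed_singleton)
      Set.inter_subset_left
  obtain ⟨w, ⟨hw, hwz⟩, hwmax⟩ := hA.exists_isMaxOn ⟨z, hz, rfl⟩ continuous_fst.continuousOn
  have hwz : u w = u z := hwz
  have hwQ : w ∈ Q := by
    by_contra hn
    have hf : w ∈ frontier Q := by rw [hQ.frontier_eq]; exact ⟨hw, hn⟩
    have h1 : u q₀ ≤ u z := hzmax hq₀
    linarith [hM w hf]
  obtain ⟨ε, hε, hball⟩ := Metric.isOpen_iff.1 hQ w hwQ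
  have hr : 0 < ε / 2 := half_pos hε
  have hd : {q : ℝ × ℝ | (q.1 - w.1) ^ 2 + (q.2 - w.2) ^ 2 ≤ (ε / 2) ^ 2} ⊆ Q := by
    intro q hq
    simp only [Set.mem_ofPred_eq] at hq
    apply hball
    rw [Metric.mem_ball, Prod.dist_eq, max_lt_iff, Real.dist_eq, Real.dist_eq]
    constructor
    · exact (abs_le_of_sq_le_sq (by linarith [sq_nonneg (q.2 - w.2)]) hr.le).trans_lt
        (half_lt_self hε)
    · exact (abs_le_of_sq_le_sq (by linarith [sq_nonneg (q.1 - w.1)]) hr.le).trans_lt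
        (half_lt_self hε)
  have hmem := fun θ => subset_closure (circle_mem_of_disc_subset hd θ)
  have hstrict : u (w.1 + ε / 2 * Real.cos 0, w.2 + ε / 2 * Real.sin 0) < u z := by
    refine lt_of_le_of_ne (hzmax (hmem 0)) fun heq => ?_
    have h1 : w.1 + ε / 2 * Real.cos 0 ≤ w.1 := hwmax ⟨hmem 0, heq⟩
    rw [Real.cos_zero] at h1
    linarith
  have hint := intervalIntegral.integral_lt_integral_of_continuousOn_of_le_of_exists_lt
    Real.two_pi_pos (continuous_circle_of_disc_subset hu.1 hd).continuousOn
    (continuousOn_const (c := u z)) (fun θ _ => hzmax (hmem θ))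
    ⟨0, ⟨le_rfl, Real.two_pi_pos.le⟩, hstrict⟩
  rw [intervalIntegral.integral_const, sub_zero, smul_eq_mul] at hint
  have hmean := hu.2 w (ε / 2) hr hd
  have hlt := mul_lt_mul_of_pos_left hint (inv_pos.2 Real.two_pi_pos)
  rw [inv_mul_cancel_left₀ Real.two_pi_pos.ne'] at hlt
  linarith

/-- If `u` is subharmonic on the square with centre `(0, t)` and half-side `t`, at most `s` on the
bottom edge and at most `p` everywhere, then its value at the centre is at most `(s + 3p)/4`. -/
theorem SubharmonicOnSet.center_le {u : ℝ × ℝ → ℝ} {t s p : ℝ} (ht : 0 < t)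
    (hu : SubharmonicOnSet u (Set.Ioo (-t) t ×ˢ Set.Ioo 0 (2 * t)))
    (hs : ∀ x ∈ Set.Icc (-t) t, u (x, 0) ≤ s)
    (hp : ∀ q ∈ Set.Icc (-t) t ×ˢ Set.Icc 0 (2 * t), u q ≤ p) :
    u (0, t) ≤ (s + 3 * p) / 4 := by
  set S : Set (ℝ × ℝ) := Set.Ioo (-t) t ×ˢ Set.Ioo 0 (2 * t) with hS
  have hrot : quarterTurn (0, t) ⁻¹' S = S := by
    ext q
    simp only [hS, quarterTurn, Set.mem_preimage, Set.mem_prod, Set.mem_Ioo]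
    constructor <;> rintro ⟨⟨_, _⟩, _, _⟩ <;> refine ⟨⟨?_, ?_⟩, ?_, ?_⟩ <;> linarith
  have hturn : ∀ w : ℝ × ℝ → ℝ, SubharmonicOnSet w S →
      SubharmonicOnSet (fun q => w (quarterTurn (0, t) q)) S := fun w hw => by
    simpa only [hrot] using hw.comp_quarterTurn (0, t)
  have hsum := ((hu.add (hturn _ hu)).add (hturn _ (hturn _ hu))).add
    (hturn _ (hturn _ (hturn _ hu)))
  have hcl : closure S = Set.Icc (-t) t ×ˢ Set.Icc 0 (2 * t) := by
    rw [hS, closure_prod_eq, closure_Ioo (by linarith), closure_Ioo (by linarith)]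
  have hopen : IsOpen S := isOpen_Ioo.prod isOpen_Ioo
  have key := hsum.le_of_le_on_frontier (M := s + 3 * p) hopen
    ((Metric.isBounded_Ioo _ _).prod (Metric.isBounded_Ioo _ _)) ?_ (0, t) ?_
  · simp only [quarterTurn, sub_self, add_zero] at key
    linarith
  · rintro ⟨x, y⟩ hq
    rw [hopen.frontier_eq, hcl] at hq
    obtain ⟨⟨⟨hx1, hx2⟩, hy1, hy2⟩, hn⟩ := hq
    simp only at hx1 hx2 hy1 hy2
    have hp' : ∀ a b : ℝ, -t ≤ a → a ≤ t → 0 ≤ b → b ≤ 2 * t → u (a, b) ≤ p :=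
      fun a b h1 h2 h3 h4 => hp (a, b) ⟨⟨h1, h2⟩, h3, h4⟩
    have b0 := hp' x y hx1 hx2 hy1 hy2
    have b1 := hp' (t - y) (t + x) (by linarith) (by linarith) (by linarith) (by linarith)
    have b2 := hp' (-x) (2 * t - y) (by linarith) (by linarith) (by linarith) (by linarith)
    have b3 := hp' (y - t) (t - x) (by linarith) (by linarith) (by linarith) (by linarith)
    have e1 : quarterTurn (0, t) (x, y) = (t - y, t + x) := by
      ext <;> simp only [quarterTurn] <;> ring
    have e2 : quarterTurn (0, t) (t - y, t + x) = (-x, 2 * t - y) := by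
      ext <;> simp only [quarterTurn] <;> ring
    have e3 : quarterTurn (0, t) (-x, 2 * t - y) = (y - t, t - x) := by
      ext <;> simp only [quarterTurn] <;> ring
    simp only [e1, e2, e3]
    have hedge : x = -t ∨ x = t ∨ y = 0 ∨ y = 2 * t := by
      by_contra! h
      exact hn ⟨⟨lt_of_le_of_ne hx1 h.1.symm, lt_of_le_of_ne hx2 h.2.1⟩,
        lt_of_le_of_ne hy1 h.2.2.1.symm, lt_of_le_of_ne hy2 h.2.2.2⟩
    rcases hedge with h | h | h | h
    · have hbot : u (t - y, t + x) ≤ s := by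
        rw [show t + x = 0 by linarith]
        exact hs _ ⟨by linarith, by linarith⟩
      linarith
    · have hbot : u (y - t, t - x) ≤ s := by
        rw [show t - x = 0 by linarith]
        exact hs _ ⟨by linarith, by linarith⟩
      linarith
    · have hbot : u (x, y) ≤ s := by
        rw [show y = 0 by linarith]
        exact hs _ ⟨by linarith, by linarith⟩
      linarith
    · have hbot : u (-x, 2 * t - y) ≤ s := by
        rw [show 2 * t - y = 0 by linarith]
        exact hs _ ⟨by linarith, by linarith⟩
      linarith
  · rw [hcl]
    exact ⟨⟨by linarith, ht.le⟩, ht.le, by linarith⟩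

/-- **Lemma 3.** If `v` is subharmonic on the square `Q = (−1,1) × (0,2)`, `v ≤ s` on
the bottom edge `γ₁` and `v ≤ p` on the other three edges, with `s < p`, then
`v ≤ (s + 3p)/4` on the segment `l = {0} × (0,1)`. -/
theorem subharmonic_segment_bound
    (v : ℝ × ℝ → ℝ)
    (hv : SubharmonicOnSet v (Set.Ioo (-1 : ℝ) 1 ×ˢ Set.Ioo (0 : ℝ) 2))
    (s p : ℝ) (hsp : s < p)
    (h₁ : ∀ q ∈ Set.Icc (-1 : ℝ) 1 ×ˢ ({0} : Set ℝ), v q ≤ s)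
    (h₂ : ∀ q ∈ ({1} : Set ℝ) ×ˢ Set.Icc (0 : ℝ) 2, v q ≤ p)
    (h₃ : ∀ q ∈ Set.Icc (-1 : ℝ) 1 ×ˢ ({2} : Set ℝ), v q ≤ p)
    (h₄ : ∀ q ∈ ({-1} : Set ℝ) ×ˢ Set.Icc (0 : ℝ) 2, v q ≤ p) :
    ∀ x₂ ∈ Set.Ioo (0 : ℝ) 1, v (0, x₂) ≤ (s + 3 * p) / 4 := by
  rintro t ⟨ht0, ht1⟩
  have hcl : closure (Set.Ioo (-1 : ℝ) 1 ×ˢ Set.Ioo (0 : ℝ) 2) =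
      Set.Icc (-1 : ℝ) 1 ×ˢ Set.Icc (0 : ℝ) 2 := by
    rw [closure_prod_eq, closure_Ioo (by norm_num), closure_Ioo (by norm_num)]
  have hmax := hv.le_of_le_on_frontier (M := p) (isOpen_Ioo.prod isOpen_Ioo)
    ((Metric.isBounded_Ioo _ _).prod (Metric.isBounded_Ioo _ _)) ?_
  · rw [hcl] at hmax
    refine (hv.mono (Set.prod_mono (Set.Ioo_subset_Ioo (by linarith) ht1.le)
      (Set.Ioo_subset_Ioo le_rfl (by linarith)))).center_le ht0 (fun x hx => ?_) fun q hq => ?_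
    · exact h₁ _ ⟨Set.Icc_subset_Icc (by linarith) ht1.le hx, rfl⟩
    · exact hmax q (Set.prod_mono (Set.Icc_subset_Icc (by linarith) ht1.le)
        (Set.Icc_subset_Icc le_rfl (by linarith)) hq)
  · intro q hq
    rw [frontier_prod_eq, closure_Ioo (by norm_num), closure_Ioo (by norm_num),
      frontier_Ioo (by norm_num), frontier_Ioo (by norm_num)] at hq
    rcases hq with ⟨hx, hy | hy⟩ | ⟨hx | hx, hy⟩
    · exact (h₁ q ⟨hx, hy⟩).trans hsp.le
    · exact h₃ q ⟨hx, hy⟩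
    · exact h₄ q ⟨hx, hy⟩
    · exact h₂ q ⟨hx, hy⟩
end

section
/- Let g : (0,∞) → ℝ be a continuous function with g(x) > 0 for all x > 0, and suppose u(x, g(x)) = 0 for every x > 0. If there exist 0 < c < d and a point x₁ ∈ (c,d) such that g(c) = g(d) and g(x₁) ≤ g(c) (so that g fails to lie strictly above its endpoint values on (c,d)), then f is identically zero on ℝ. In other words, if f is not identically zero then for all 0 < c < d with g(c) = g(d) one has g(x) > g(c) for every x ∈ (c,d). -/
open MeasureTheory Real

/-- A continuous weight times a Gaussian has a moment-generating function defined everywhere. -/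
lemma integrable_exp_neg_sq_mul_mul_exp {s : ℝ} (hs : 0 < s) {w : ℝ → ℝ} (hw : Continuous w)
    {K : ℝ} (hK : ∀ y, |w y| ≤ K) (t : ℝ) :
    Integrable (fun y : ℝ => exp (-y ^ 2 / (4 * s)) * w y * exp (t * y)) := by
  have hg : Integrable (fun y : ℝ => K * exp (2 * s * t ^ 2) * exp (-(1 / (8 * s)) * y ^ 2)) :=
    (integrable_exp_neg_mul_sq (by positivity)).const_mul _
  refine hg.mono' (by fun_prop) (Filter.Eventually.of_forall fun y => ?_)
  have h1 : exp (-y ^ 2 / (4 * s)) * exp (t * y)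
      ≤ exp (2 * s * t ^ 2) * exp (-(1 / (8 * s)) * y ^ 2) := by
    rw [← exp_add, ← exp_add, exp_le_exp]
    have : 2 * s * t ^ 2 + -(1 / (8 * s)) * y ^ 2 - (-y ^ 2 / (4 * s) + t * y)
        = (y - 4 * s * t) ^ 2 / (8 * s) := by field_simp; ring
    have h2 : 0 ≤ (y - 4 * s * t) ^ 2 / (8 * s) := by positivity
    linarith
  have hK0 : 0 ≤ K := (abs_nonneg _).trans (hK 0)
  rw [norm_mul, norm_mul, norm_of_nonneg (exp_pos _).le, norm_of_nonneg (exp_pos _).le,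
    norm_eq_abs]
  calc exp (-y ^ 2 / (4 * s)) * |w y| * exp (t * y)
      = |w y| * (exp (-y ^ 2 / (4 * s)) * exp (t * y)) := by ring
    _ ≤ K * (exp (2 * s * t ^ 2) * exp (-(1 / (8 * s)) * y ^ 2)) :=
        mul_le_mul (hK y) h1 (by positivity) hK0
    _ = _ := by ring

/-- The measure with density `exp (-y² / (4 s)) w y`. -/
noncomputable def gaussianWeight (s : ℝ) (w : ℝ → ℝ) : Measure ℝ :=
  volume.withDensity (fun y => ENNReal.ofReal (exp (-y ^ 2 / (4 * s)) * w y))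

section gaussianWeight

variable {s : ℝ} {w : ℝ → ℝ} {K : ℝ}

lemma integrableExpSet_gaussianWeight (hs : 0 < s) (hw : Continuous w) (hK : ∀ y, |w y| ≤ K)
    (hw0 : ∀ y, 0 ≤ w y) :
    ProbabilityTheory.integrableExpSet id (gaussianWeight s w) = Set.univ := by
  refine Set.eq_univ_of_forall fun t => ?_
  change Integrable _ _
  rw [gaussianWeight, integrable_withDensity_iff_integrable_smul' (by fun_prop) (by simp)]
  refine (integrable_exp_neg_sq_mul_mul_exp hs hw hK t).congr (.of_forall fun y => ?_)
  simp [ENNReal.toReal_ofReal (mul_nonneg (exp_pos (-y ^ 2 / (4 * s))).le (hw0 y))]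

lemma mgf_gaussianWeight (hw : Continuous w) (hw0 : ∀ y, 0 ≤ w y) (t : ℝ) :
    ProbabilityTheory.mgf id (gaussianWeight s w) t =
      ∫ y : ℝ, exp (-y ^ 2 / (4 * s)) * w y * exp (t * y) := by
  rw [ProbabilityTheory.mgf, gaussianWeight,
    integral_withDensity_eq_integral_toReal_smul (by fun_prop) (by simp)]
  refine integral_congr_ae (.of_forall fun y => ?_)
  simp [ENNReal.toReal_ofReal (mul_nonneg (exp_pos (-y ^ 2 / (4 * s))).le (hw0 y))]

lemma isFiniteMeasure_gaussianWeight (hs : 0 < s) (hw : Continuous w) (hK : ∀ y, |w y| ≤ K)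
    (hw0 : ∀ y, 0 ≤ w y) : IsFiniteMeasure (gaussianWeight s w) := by
  have h : (0 : ℝ) ∈ ProbabilityTheory.integrableExpSet id (gaussianWeight s w) := by
    rw [integrableExpSet_gaussianWeight hs hw hK hw0]; trivial
  have h1 : Integrable (fun _ : ℝ => (1 : ℝ)) (gaussianWeight s w) := by
    simpa [ProbabilityTheory.integrableExpSet] using h
  exact (integrable_const_iff_isFiniteMeasure one_ne_zero).1 h1

end gaussianWeight

/-- Two finite measures with entire moment-generating functions that agree near a point
are equal. -/
lemma measure_eq_of_mgf_eventuallyEq {μ ν : Measure ℝ} [IsFiniteMeasure μ] [IsFiniteMeasure ν]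
    (hμ : ProbabilityTheory.integrableExpSet id μ = Set.univ)
    (hν : ProbabilityTheory.integrableExpSet id ν = Set.univ) {t : ℝ}
    (h : ProbabilityTheory.mgf id μ =ᶠ[nhds t] ProbabilityTheory.mgf id ν) : μ = ν := by
  have aμ := ProbabilityTheory.analyticOnNhd_mgf (X := id) (μ := μ)
  have aν := ProbabilityTheory.analyticOnNhd_mgf (X := id) (μ := ν)
  rw [hμ, interior_univ] at aμ
  rw [hν, interior_univ] at aν
  have heq : ProbabilityTheory.mgf id μ = ProbabilityTheory.mgf id ν :=
    aμ.eq_of_eventuallyEq aν h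
  have h0 : μ = 0 ↔ ν = 0 := by
    have := congrFun heq 0
    rw [ProbabilityTheory.mgf_zero', ProbabilityTheory.mgf_zero'] at this
    rw [← Measure.measure_univ_eq_zero, ← Measure.measure_univ_eq_zero,
      ← measureReal_eq_zero_iff, ← measureReal_eq_zero_iff, this]
  refine Measure.ext_of_complexMGF_id_eq (funext fun z => ?_)
  refine ProbabilityTheory.eqOn_complexMGF_of_mgf' heq h0 ?_
  simp [hμ]

/-- If the caloric extension of `f` vanishes at one positive time on an open interval,
then `f` vanishes. -/
lemma eq_zero_of_integral_exp_eq_zero {f : ℝ → ℝ} (hf : Continuous f) {M : ℝ}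
    (hM : ∀ x, |f x| ≤ M) {s : ℝ} (hs : 0 < s) {x₀ : ℝ}
    (h : ∀ᶠ x in nhds x₀, ∫ y : ℝ, exp (-((x - y) ^ 2) / (4 * s)) * f y = 0) (x : ℝ) :
    f x = 0 := by
  have hM0 : 0 ≤ M := (abs_nonneg _).trans (hM 0)
  have c1 : Continuous fun y => f y + M := by fun_prop
  have c2 : Continuous fun _ : ℝ => M := continuous_const
  have n1 : ∀ y, 0 ≤ f y + M := fun y => by linarith [neg_abs_le (f y), hM y]
  have b1 : ∀ y, |f y + M| ≤ 2 * M := fun y => by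
    rw [abs_of_nonneg (n1 y)]; linarith [le_abs_self (f y), hM y]
  have b2 : ∀ _ : ℝ, |M| ≤ M := fun _ => (abs_of_nonneg hM0).le
  have := isFiniteMeasure_gaussianWeight hs c1 b1 n1
  have := isFiniteMeasure_gaussianWeight hs c2 b2 fun _ => hM0
  have heq : gaussianWeight s (fun y => f y + M) = gaussianWeight s (fun _ => M) := by
    refine measure_eq_of_mgf_eventuallyEq (t := x₀ / (2 * s))
      (integrableExpSet_gaussianWeight hs c1 b1 n1)
      (integrableExpSet_gaussianWeight hs c2 b2 fun _ => hM0) ?_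
    have ht : Filter.Tendsto (fun t : ℝ => t * (2 * s)) (nhds (x₀ / (2 * s))) (nhds x₀) := by
      have : Continuous fun t : ℝ => t * (2 * s) := by fun_prop
      convert this.tendsto (x₀ / (2 * s)) using 2
      field_simp
    filter_upwards [ht.eventually h] with t h0
    rw [mgf_gaussianWeight c1 n1, mgf_gaussianWeight c2 fun _ => hM0, ← sub_eq_zero,
      ← integral_sub (integrable_exp_neg_sq_mul_mul_exp hs c1 b1 t)
        (integrable_exp_neg_sq_mul_mul_exp hs c2 b2 t)]
    rw [← mul_zero (exp ((t * (2 * s)) ^ 2 / (4 * s))), ← h0, ← integral_const_mul]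
    refine integral_congr_ae (.of_forall fun y => ?_)
    have : exp ((t * (2 * s)) ^ 2 / (4 * s)) * exp (-((t * (2 * s) - y) ^ 2) / (4 * s))
        = exp (-y ^ 2 / (4 * s)) * exp (t * y) := by
      rw [← exp_add, ← exp_add]; congr 1; field_simp; ring
    dsimp only
    rw [← mul_assoc, this]; ring
  rw [gaussianWeight, gaussianWeight, withDensity_eq_iff_of_sigmaFinite (by fun_prop)
    (by fun_prop)] at heq
  have hx := congrFun ((Continuous.ae_eq_iff_eq volume
    (ENNReal.continuous_ofReal.comp (by fun_prop))
    (ENNReal.continuous_ofReal.comp (by fun_prop))).1 heq) x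
  rw [Function.comp_apply, Function.comp_apply,
    ENNReal.ofReal_eq_ofReal_iff (mul_nonneg (exp_pos _).le (n1 x))
    (mul_nonneg (exp_pos _).le hM0)] at hx
  have := mul_left_cancel₀ (exp_pos _).ne' hx
  linarith

lemma pow_mul_exp_neg_sq_le (n : ℕ) (R : ℝ) {T : ℝ} (hT : 0 < T) :
    ∃ C : ℝ, ∀ x t y : ℝ, |x| ≤ R → 0 < t → t ≤ T →
      |(x - y) ^ n * exp (-((x - y) ^ 2) / (4 * t))| ≤ C * exp (-(1 / (16 * T)) * y ^ 2) := by
  refine ⟨n.factorial * exp (2 * T + R ^ 2 / (8 * T)), fun x t y hx ht htT => ?_⟩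
  have h1 : |x - y| ^ n ≤ n.factorial * exp |x - y| := by
    have := pow_div_factorial_le_exp |x - y| (abs_nonneg _) n
    rwa [div_le_iff₀' (by positivity)] at this
  have h2 : -((x - y) ^ 2) / (4 * t) ≤ -((x - y) ^ 2) / (4 * T) := by
    rw [neg_div, neg_div, neg_le_neg_iff]
    gcongr
  have h3 : x ^ 2 ≤ R ^ 2 := sq_le_sq' (by linarith [neg_abs_le x]) ((le_abs_self x).trans hx)
  have h4 : |x - y| + -((x - y) ^ 2) / (4 * T)
      ≤ 2 * T + R ^ 2 / (8 * T) + -(1 / (16 * T)) * y ^ 2 := by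
    have e : 2 * T + R ^ 2 / (8 * T) + -(1 / (16 * T)) * y ^ 2
        - (|x - y| + -(|x - y| ^ 2) / (4 * T))
        = (2 * (|x - y| - 4 * T) ^ 2 + (2 * |x - y| ^ 2 + 2 * R ^ 2 - y ^ 2)) / (16 * T) := by
      field_simp
      ring
    have e' : 0 ≤ (2 * (|x - y| - 4 * T) ^ 2 + (2 * |x - y| ^ 2 + 2 * R ^ 2 - y ^ 2))
        / (16 * T) := by
      refine div_nonneg (add_nonneg (by positivity) ?_) (by positivity)
      rw [sq_abs (x - y)]
      nlinarith [sq_nonneg (2 * x - y)]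
    rw [sq_abs] at e e'
    linarith
  rw [abs_mul, abs_pow, abs_of_pos (exp_pos _)]
  calc |x - y| ^ n * exp (-((x - y) ^ 2) / (4 * t))
      ≤ (n.factorial * exp |x - y|) * exp (-((x - y) ^ 2) / (4 * T)) := by gcongr
    _ = n.factorial * exp (|x - y| + -((x - y) ^ 2) / (4 * T)) := by rw [exp_add]; ring
    _ ≤ n.factorial * exp (2 * T + R ^ 2 / (8 * T) + -(1 / (16 * T)) * y ^ 2) := by gcongr
    _ = _ := by rw [exp_add]; ring

/-- The integral of `f` against the unnormalized heat kernel times `(x - y) ^ n`. -/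
noncomputable def heatMoment (f : ℝ → ℝ) (n : ℕ) (x t : ℝ) : ℝ :=
  ∫ y : ℝ, (x - y) ^ n * exp (-((x - y) ^ 2) / (4 * t)) * f y

section heatMoment

variable {f : ℝ → ℝ} {M : ℝ}

lemma heatMoment_bound (hM : ∀ x, |f x| ≤ M) (n : ℕ) (R : ℝ) {T : ℝ} (hT : 0 < T) :
    ∃ b : ℝ → ℝ, Integrable b ∧ ∀ x t y : ℝ, |x| ≤ R → 0 < t → t ≤ T →
      ‖(x - y) ^ n * exp (-((x - y) ^ 2) / (4 * t)) * f y‖ ≤ b y := by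
  obtain ⟨C, hC⟩ := pow_mul_exp_neg_sq_le n R hT
  refine ⟨fun y => C * exp (-(1 / (16 * T)) * y ^ 2) * M,
    ((integrable_exp_neg_mul_sq (by positivity)).const_mul _).mul_const _,
    fun x t y hx ht htT => ?_⟩
  rw [norm_mul]
  exact mul_le_mul (hC x t y hx ht htT) (hM y) (abs_nonneg _)
    ((abs_nonneg _).trans (hC x t y hx ht htT))

lemma integrable_heatMoment (hf : Continuous f) (hM : ∀ x, |f x| ≤ M) (n : ℕ) (x : ℝ) {t : ℝ}
    (ht : 0 < t) :
    Integrable fun y : ℝ => (x - y) ^ n * exp (-((x - y) ^ 2) / (4 * t)) * f y := by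
  obtain ⟨b, hb, hle⟩ := heatMoment_bound hM n |x| ht
  exact hb.mono' (by fun_prop) (.of_forall fun y => hle x t y le_rfl ht le_rfl)

lemma hasDerivAt_heatMoment_space (hf : Continuous f) (hM : ∀ x, |f x| ≤ M) (n : ℕ) (x : ℝ)
    {t : ℝ} (ht : 0 < t) :
    HasDerivAt (fun x => heatMoment f n x t)
      (n * heatMoment f (n - 1) x t - heatMoment f (n + 1) x t / (2 * t)) x := by
  obtain ⟨b₁, hb₁, hle₁⟩ := heatMoment_bound hM (n - 1) (|x| + 1) ht
  obtain ⟨b₂, hb₂, hle₂⟩ := heatMoment_bound hM (n + 1) (|x| + 1) ht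
  have key := (hasDerivAt_integral_of_dominated_loc_of_deriv_le (μ := volume) (x₀ := x)
    (F := fun x y => (x - y) ^ n * exp (-((x - y) ^ 2) / (4 * t)) * f y)
    (F' := fun x y => n * ((x - y) ^ (n - 1) * exp (-((x - y) ^ 2) / (4 * t)) * f y)
      - (x - y) ^ (n + 1) * exp (-((x - y) ^ 2) / (4 * t)) * f y / (2 * t))
    (bound := fun y => n * b₁ y + b₂ y / (2 * t))
    (Metric.ball_mem_nhds x one_pos) (.of_forall fun x => by fun_prop)
    (integrable_heatMoment hf hM n x ht) (by fun_prop) (.of_forall fun y z hz => ?_)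
    ((hb₁.const_mul _).add (hb₂.div_const _)) (.of_forall fun y z _ => ?_)).2
  · rwa [integral_sub ((integrable_heatMoment hf hM _ x ht).const_mul _)
      ((integrable_heatMoment hf hM _ x ht).div_const _), integral_const_mul,
      integral_div] at key
  · have hz' : |z| ≤ |x| + 1 := by
      rw [Metric.mem_ball, dist_eq] at hz
      linarith [abs_sub_abs_le_abs_sub z x]
    refine (norm_sub_le _ _).trans ?_
    rw [norm_mul, norm_div, norm_of_nonneg (by positivity : (0 : ℝ) ≤ n),
      norm_of_nonneg (by positivity : 0 ≤ 2 * t)]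
    gcongr
    · exact hle₁ z t y hz' ht le_rfl
    · exact hle₂ z t y hz' ht le_rfl
  · have h1 : HasDerivAt (fun z => z - y) 1 z := (hasDerivAt_id z).sub_const y
    have h2 := (((h1.pow n).mul (((h1.pow 2).neg.div_const (4 * t)).exp)).mul_const (f y))
    refine h2.congr_deriv ?_
    simp only [Pi.pow_apply, Pi.neg_apply]
    field_simp
    ring

lemma hasDerivAt_heatMoment_time (hf : Continuous f) (hM : ∀ x, |f x| ≤ M) (n : ℕ) (x : ℝ)
    {t : ℝ} (ht : 0 < t) :
    HasDerivAt (fun t => heatMoment f n x t) (heatMoment f (n + 2) x t / (4 * t ^ 2)) t := by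
  obtain ⟨b, hb, hle⟩ := heatMoment_bound hM (n + 2) |x| (T := 2 * t) (by positivity)
  have key := (hasDerivAt_integral_of_dominated_loc_of_deriv_le (μ := volume) (x₀ := t)
    (F := fun t y => (x - y) ^ n * exp (-((x - y) ^ 2) / (4 * t)) * f y)
    (F' := fun t y => (x - y) ^ (n + 2) * exp (-((x - y) ^ 2) / (4 * t)) * f y / (4 * t ^ 2))
    (bound := fun y => b y / (4 * (t / 2) ^ 2))
    (Ioo_mem_nhds (half_lt_self ht) (by linarith : t < 2 * t))
    (.of_forall fun x => by fun_prop)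
    (integrable_heatMoment hf hM n x ht) (by fun_prop) (.of_forall fun y z hz => ?_)
    (hb.div_const _) (.of_forall fun y z hz => ?_)).2
  · rwa [integral_div] at key
  · have hz0 : 0 < z := (half_pos ht).trans hz.1
    rw [norm_div, norm_of_nonneg (by positivity : 0 ≤ 4 * z ^ 2)]
    have := hle x z y le_rfl hz0 hz.2.le
    have := hz.1.le
    have : 0 ≤ b y := (norm_nonneg _).trans (hle x z y le_rfl hz0 hz.2.le)
    gcongr
  · have hz0 : 0 < z := (half_pos ht).trans hz.1
    have h1 : HasDerivAt (fun z : ℝ => 4 * z) 4 z := by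
      simpa using (hasDerivAt_id z).const_mul 4
    have h2 := ((((hasDerivAt_const z (-((x - y) ^ 2))).div h1 (by positivity)).exp).const_mul
      ((x - y) ^ n)).mul_const (f y)
    refine h2.congr_deriv ?_
    simp only [Pi.div_apply]
    field_simp
    ring

lemma continuousOn_heatMoment (hf : Continuous f) (hM : ∀ x, |f x| ≤ M) (n : ℕ) :
    ContinuousOn (fun p : ℝ × ℝ => heatMoment f n p.1 p.2) {p | 0 < p.2} := by
  rintro ⟨x, t⟩ (ht : 0 < t)
  refine ContinuousAt.continuousWithinAt ?_
  obtain ⟨b, hb, hle⟩ := heatMoment_bound hM n (|x| + 1) (T := 2 * t) (by positivity)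
  refine continuousAt_of_dominated (bound := b) (.of_forall fun p => by fun_prop) ?_ hb
    (.of_forall fun y => ?_)
  · filter_upwards [prod_mem_nhds (Metric.ball_mem_nhds x one_pos)
      (Ioo_mem_nhds ht (by linarith : t < 2 * t))] with p hp
    refine .of_forall fun y => hle _ _ y ?_ hp.2.1 hp.2.2.le
    have := hp.1
    rw [Metric.mem_ball, dist_eq] at this
    linarith [abs_sub_abs_le_abs_sub p.1 x]
  · have : 4 * (x, t).2 ≠ 0 := by simp [ht.ne']
    fun_prop (disch := assumption)

end heatMoment

lemma IsLocalMax.second_deriv_nonpos {φ φ' : ℝ → ℝ} {φ'' x : ℝ} (h : IsLocalMax φ x)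
    (h1 : ∀ y, HasDerivAt φ (φ' y) y) (h2 : HasDerivAt φ' φ'' x) : φ'' ≤ 0 := by
  by_contra! hpos
  have e1 : deriv φ = φ' := funext fun y => (h1 y).deriv
  have hmin : IsLocalMin φ x :=
    isLocalMin_of_deriv_deriv_pos (by rw [e1, h2.deriv]; exact hpos) h.deriv_eq_zero
      (h1 x).continuousAt
  have hc : φ =ᶠ[nhds x] fun _ => φ x := by
    filter_upwards [h, hmin] with y a b using le_antisymm a b
  have := hc.deriv.deriv_eq
  rw [e1, h2.deriv] at this
  simp at this
  exact hpos.ne' this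

lemma HasDerivAt.nonneg_of_eventually_le_left {φ : ℝ → ℝ} {φ' t : ℝ} (h : HasDerivAt φ φ' t)
    (hle : ∀ᶠ r in nhdsWithin t (Set.Iio t), φ r ≤ φ t) : 0 ≤ φ' := by
  have hs := (hasDerivAt_iff_tendsto_slope.1 h).mono_left (nhdsLT_le_nhdsNE t)
  refine ge_of_tendsto hs ?_
  filter_upwards [hle, self_mem_nhdsWithin] with r hr (hrt : r < t)
  rw [slope_def_field]
  exact div_nonneg_of_nonpos (by linarith) (by linarith)

/-- Weak maximum principle for the heat equation on the region between a graph and a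
horizontal segment lying below the endpoints of the graph. -/
lemma heat_nonpos_above_graph {v vx vxx : ℝ → ℝ → ℝ}
    (h1 : ∀ x t, 0 < t → HasDerivAt (fun x => v x t) (vx x t) x)
    (h2 : ∀ x t, 0 < t → HasDerivAt (fun x => vx x t) (vxx x t) x)
    (h3 : ∀ x t, 0 < t → HasDerivAt (fun t => v x t) (vxx x t) t)
    (hv : ContinuousOn (fun p : ℝ × ℝ => v p.1 p.2) {p | 0 < p.2})
    {g : ℝ → ℝ} {p q s : ℝ} (hg : ContinuousOn g (Set.Icc p q))
    (hg0 : ∀ x ∈ Set.Icc p q, 0 < g x) (hvg : ∀ x ∈ Set.Icc p q, v x (g x) = 0)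
    (hp : s < g p) (hq : s < g q) {x t : ℝ} (hx : x ∈ Set.Icc p q) (hxt : g x ≤ t)
    (hts : t ≤ s) : v x t ≤ 0 := by
  set K : Set (ℝ × ℝ) := {z ∈ Set.Icc p q ×ˢ Set.Icc 0 s | g z.1 ≤ z.2} with hK
  have hKc : IsCompact K := by
    refine (isCompact_Icc.prod isCompact_Icc).of_isClosed_subset ?_ (Set.sep_subset _ _)
    exact (isClosed_Icc.prod isClosed_Icc).isClosed_le
      (hg.comp continuousOn_fst fun z hz => hz.1) continuousOn_snd
  have hKpos : ∀ z ∈ K, 0 < z.2 := fun z hz => (hg0 _ hz.1.1).trans_le hz.2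
  have hmem : (x, t) ∈ K := ⟨⟨hx, ((hg0 x hx).trans_le hxt).le, hts⟩, hxt⟩
  have ht0 : 0 < t := hKpos _ hmem
  refine le_of_forall_pos_le_add fun δ hδ => ?_
  set ε := δ / t with hε
  have hε0 : 0 < ε := div_pos hδ ht0
  obtain ⟨⟨x₀, t₀⟩, hz, hmax⟩ := hKc.exists_isMaxOn ⟨_, hmem⟩
    (f := fun z => v z.1 z.2 - ε * z.2)
    ((hv.mono hKpos).sub (by fun_prop))
  have ht₀ : 0 < t₀ := hKpos _ hz
  have hneg : v x₀ t₀ - ε * t₀ ≤ 0 := by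
    rcases hz.2.eq_or_lt with he | hlt
    · simp only at he
      rw [← he, hvg x₀ hz.1.1]
      have := hg0 x₀ hz.1.1
      nlinarith
    · exfalso
      simp only at hlt
      have hx₀ : x₀ ∈ Set.Ioo p q := by
        have hle : t₀ ≤ s := hz.1.2.2
        refine ⟨lt_of_le_of_ne hz.1.1.1 ?_, lt_of_le_of_ne hz.1.1.2 ?_⟩
        · rintro rfl; linarith
        · rintro rfl; linarith
      have hgx : ContinuousAt g x₀ := hg.continuousAt (Icc_mem_nhds hx₀.1 hx₀.2)
      have hxx : vxx x₀ t₀ ≤ 0 := by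
        refine IsLocalMax.second_deriv_nonpos (φ := fun x => v x t₀) ?_
          (fun y => h1 y t₀ ht₀) (h2 x₀ t₀ ht₀)
        filter_upwards [hgx.eventually_lt_const hlt, Icc_mem_nhds hx₀.1 hx₀.2] with y hy hy'
        have := hmax (show (y, t₀) ∈ K from ⟨⟨hy', hz.1.2⟩, hy.le⟩)
        simpa using this
      have htt : 0 ≤ vxx x₀ t₀ - ε := by
        have hd : HasDerivAt (fun t => v x₀ t - ε * t) (vxx x₀ t₀ - ε) t₀ := by
          have := (h3 x₀ t₀ ht₀).sub ((hasDerivAt_id t₀).const_mul ε)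
          rwa [mul_one] at this
        refine hd.nonneg_of_eventually_le_left ?_
        filter_upwards [Ioo_mem_nhdsLT hlt] with r hr
        exact hmax (show (x₀, r) ∈ K from
          ⟨⟨hz.1.1, ((hg0 x₀ hz.1.1).trans hr.1).le, hr.2.le.trans hz.1.2.2⟩, hr.1.le⟩)
      linarith
  have h : v x t - ε * t ≤ v x₀ t₀ - ε * t₀ := hmax hmem
  have : ε * t = δ := div_mul_cancel₀ _ ht0.ne'
  linarith

lemma heat_eq_zero_above_graph {v vx vxx : ℝ → ℝ → ℝ}
    (h1 : ∀ x t, 0 < t → HasDerivAt (fun x => v x t) (vx x t) x)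
    (h2 : ∀ x t, 0 < t → HasDerivAt (fun x => vx x t) (vxx x t) x)
    (h3 : ∀ x t, 0 < t → HasDerivAt (fun t => v x t) (vxx x t) t)
    (hv : ContinuousOn (fun p : ℝ × ℝ => v p.1 p.2) {p | 0 < p.2})
    {g : ℝ → ℝ} {p q s : ℝ} (hg : ContinuousOn g (Set.Icc p q))
    (hg0 : ∀ x ∈ Set.Icc p q, 0 < g x) (hvg : ∀ x ∈ Set.Icc p q, v x (g x) = 0)
    (hp : s < g p) (hq : s < g q) {x t : ℝ} (hx : x ∈ Set.Icc p q) (hxt : g x ≤ t)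
    (hts : t ≤ s) : v x t = 0 := by
  refine le_antisymm (heat_nonpos_above_graph h1 h2 h3 hv hg hg0 hvg hp hq hx hxt hts) ?_
  have := heat_nonpos_above_graph (v := fun x t => -v x t) (vx := fun x t => -vx x t)
    (vxx := fun x t => -vxx x t) (fun x t ht => (h1 x t ht).neg) (fun x t ht => (h2 x t ht).neg)
    (fun x t ht => (h3 x t ht).neg) hv.neg hg hg0 (fun x hx => by rw [hvg x hx, neg_zero])
    hp hq hx hxt hts
  linarith

/-- The caloric extension of bounded continuous data vanishes above a local dip of a graph on
which it vanishes. -/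
lemma heatMoment_eq_zero_above_graph {f : ℝ → ℝ} (hf : Continuous f) {M : ℝ}
    (hM : ∀ x, |f x| ≤ M) {g : ℝ → ℝ} {p q s : ℝ} (hg : ContinuousOn g (Set.Icc p q))
    (hg0 : ∀ x ∈ Set.Icc p q, 0 < g x) (hvg : ∀ x ∈ Set.Icc p q, heatMoment f 0 x (g x) = 0)
    (hp : s < g p) (hq : s < g q) {x t : ℝ} (hx : x ∈ Set.Icc p q) (hxt : g x ≤ t)
    (hts : t ≤ s) : heatMoment f 0 x t = 0 := by
  have ht : 0 < t := (hg0 x hx).trans_le hxt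
  have key := heat_eq_zero_above_graph
    (v := fun x t => (√t)⁻¹ * heatMoment f 0 x t)
    (vx := fun x t => (√t)⁻¹ * (-(heatMoment f 1 x t / (2 * t))))
    (vxx := fun x t =>
      (√t)⁻¹ * (-((heatMoment f 0 x t - heatMoment f 2 x t / (2 * t)) / (2 * t))))
    (fun x t ht => ?_) (fun x t ht => ?_) (fun x t ht => ?_) ?_ hg hg0
    (fun x hx => by rw [hvg x hx, mul_zero]) hp hq hx hxt hts
  · exact (mul_eq_zero.1 key).resolve_left (inv_ne_zero (sqrt_pos.2 ht).ne')
  · simpa using (hasDerivAt_heatMoment_space hf hM 0 x ht).const_mul (√t)⁻¹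
  · have := (((hasDerivAt_heatMoment_space hf hM 1 x ht).div_const (2 * t)).fun_neg).const_mul
      (√t)⁻¹
    simpa using this
  · have h := ((hasDerivAt_sqrt ht.ne').fun_inv (sqrt_pos.2 ht).ne').mul
      (hasDerivAt_heatMoment_time hf hM 0 x ht)
    refine h.congr_deriv ?_
    have hs : √t ≠ 0 := (sqrt_pos.2 ht).ne'
    rw [sq_sqrt ht.le]
    field_simp
    ring
  · refine ContinuousOn.mul ?_ (continuousOn_heatMoment hf hM 0)
    exact ContinuousOn.inv₀ (by fun_prop) fun z (hz : 0 < z.2) => (sqrt_pos.2 hz).ne'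

lemma exists_isMinOn_mem_Ioo {g : ℝ → ℝ} {c d x₁ : ℝ} (hg : ContinuousOn g (Set.Icc c d))
    (hx₁ : x₁ ∈ Set.Ioo c d) (hc : g x₁ ≤ g c) (hd : g x₁ ≤ g d) :
    ∃ z ∈ Set.Ioo c d, ∀ x ∈ Set.Icc c d, g z ≤ g x := by
  obtain ⟨z, hz, hmin⟩ := isCompact_Icc.exists_isMinOn ⟨x₁, Set.Ioo_subset_Icc_self hx₁⟩ hg
  by_cases h : z ∈ Set.Ioo c d
  · exact ⟨z, h, fun x hx => hmin hx⟩
  · refine ⟨x₁, hx₁, fun x hx => le_trans ?_ (hmin hx : g z ≤ g x)⟩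
    rcases hz.1.eq_or_lt with rfl | h1
    · exact hc
    rcases hz.2.eq_or_lt with rfl | h2
    · exact hd
    exact absurd ⟨h1, h2⟩ h

/-- If `u` vanishes on the graph of a positive continuous function `g` on `(0,∞)`,
and `g` fails to lie strictly above its endpoint values on some interval `(c,d)`
with `g(c) = g(d)`, then the initial data `f` vanishes identically. -/
theorem heat_graph_no_local_min
    (f : ℝ → ℝ) (hf_cont : Continuous f) (M : ℝ) (hf_bdd : ∀ x, |f x| ≤ M)
    (u : ℝ → ℝ → ℝ)
    (hu : ∀ x t, 0 < t →
      u x t = (Real.sqrt (4 * Real.pi * t))⁻¹ *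
        ∫ y : ℝ, Real.exp (-((x - y) ^ 2) / (4 * t)) * f y)
    (hu0 : ∀ x, u x 0 = f x)
    (g : ℝ → ℝ) (hg_cont : ContinuousOn g (Set.Ioi 0))
    (hg_pos : ∀ x, 0 < x → 0 < g x)
    (hvanish : ∀ x, 0 < x → u x (g x) = 0)
    (c d x₁ : ℝ) (hc : 0 < c) (hcd : c < d)
    (hx₁ : x₁ ∈ Set.Ioo c d) (hgcd : g c = g d) (hfail : g x₁ ≤ g c) :
    ∀ x : ℝ, f x = 0 := by
  have hv : ∀ x, 0 < x → heatMoment f 0 x (g x) = 0 := fun x hx => by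
    have h := hvanish x hx
    have hgx := hg_pos x hx
    rw [hu x _ hgx] at h
    simpa [heatMoment] using (mul_eq_zero.1 h).resolve_left (by positivity)
  suffices h : ∃ s, 0 < s ∧ ∃ x₀, ∀ᶠ x in nhds x₀, heatMoment f 0 x s = 0 by
    obtain ⟨s, hs, x₀, h⟩ := h
    refine eq_zero_of_integral_exp_eq_zero hf_cont hf_bdd hs (x₀ := x₀) ?_
    simpa [heatMoment] using h
  obtain ⟨z, hz, hmin⟩ := exists_isMinOn_mem_Ioo
    (hg_cont.mono fun x hx => hc.trans_le hx.1) hx₁ hfail (hgcd ▸ hfail)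
  have hz0 : 0 < z := hc.trans hz.1
  have hflat : ∀ a b, c ≤ a → b ≤ d → a < b → (∀ x ∈ Set.Icc a b, g x ≤ g z) →
      ∃ s, 0 < s ∧ ∃ x₀, ∀ᶠ x in nhds x₀, heatMoment f 0 x s = 0 := by
    intro a b ha hb hab hle
    refine ⟨g z, hg_pos z hz0, (a + b) / 2, ?_⟩
    filter_upwards [Icc_mem_nhds (by linarith : a < (a + b) / 2)
      (by linarith : (a + b) / 2 < b)] with x hx
    have hxc : c ≤ x := ha.trans hx.1
    rw [← le_antisymm (hle x hx) (hmin x ⟨hxc, hx.2.trans hb⟩)]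
    exact hv x (hc.trans_le hxc)
  by_cases hl : ∀ x ∈ Set.Icc c z, g x ≤ g z
  · exact hflat c z le_rfl hz.2.le hz.1 hl
  by_cases hr : ∀ x ∈ Set.Icc z d, g x ≤ g z
  · exact hflat z d hz.1.le le_rfl hz.2 hr
  push Not at hl hr
  obtain ⟨p, hp, hgp⟩ := hl
  obtain ⟨q, hq, hgq⟩ := hr
  have hpz : p < z := lt_of_le_of_ne hp.2 (by rintro rfl; exact hgp.false)
  have hzq : z < q := lt_of_le_of_ne hq.1 (by rintro rfl; exact hgq.false)
  obtain ⟨s, hzs, hs⟩ := exists_between (lt_min hgp hgq)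
  have hpos : ∀ x ∈ Set.Icc p q, 0 < x := fun x hx => hc.trans_le (hp.1.trans hx.1)
  refine ⟨s, (hg_pos z hz0).trans hzs, z, ?_⟩
  have hgz : ContinuousAt g z := hg_cont.continuousAt (Ioi_mem_nhds hz0)
  filter_upwards [hgz.eventually_lt_const hzs, Icc_mem_nhds hpz hzq] with x hx hx'
  exact heatMoment_eq_zero_above_graph hf_cont hf_bdd (hg_cont.mono hpos)
    (fun x hx => hg_pos x (hpos x hx)) (fun x hx => hv x (hpos x hx))
    (hs.trans_le (min_le_left _ _)) (hs.trans_le (min_le_right _ _)) hx' hx.le le_rfl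
end
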